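/- Let F be a field of characteristic 0 and A a commutative unital F-algebra. The cochain maps p₀*, p₁* : Ω•(A[x]) → Ω•(A) induced by the evaluations x ↦ 0 and x ↦ 1 induce equal maps on de Rham cohomology in every degree. -/

import Mathlib

universe u

/-- A differential graded-commutative `F`-algebra structure on `B`: an `ℕ`-grading by
`F`-subspaces making `B` a graded algebra, together with a square-zero degree-`1` differential
satisfying the graded Leibniz rule, the multiplication being graded-commutative. -/
structure DGCAOn (F : Type u) [Field F] (B : Type u) [Ring B] [Algebra F B] where
  grading : ℕ → Submodule F B
  graded : GradedAlgebra grading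
  d : B →ₗ[F] B
  d_mem : ∀ n, ∀ x ∈ grading n, d x ∈ grading (n + 1)
  d_sq : ∀ x : B, d (d x) = 0
  leibniz : ∀ i : ℕ, ∀ x ∈ grading i, ∀ y : B,
    d (x * y) = d x * y + ((-1 : F) ^ i) • (x * d y)
  gcomm : ∀ i j : ℕ, ∀ x ∈ grading i, ∀ y ∈ grading j,
    x * y = ((-1 : F) ^ (i * j)) • (y * x)

/-- A morphism of differential graded-commutative algebras: an algebra morphism preserving the
grading and commuting with the differentials. -/
def IsDGCAHom {F : Type u} [Field F] {B C : Type u} [Ring B] [Algebra F B] [Ring C]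
    [Algebra F C] (S : DGCAOn F B) (T : DGCAOn F C) (g : B →ₐ[F] C) : Prop :=
  (∀ n, ∀ x ∈ S.grading n, g x ∈ T.grading n) ∧ ∀ x : B, g (S.d x) = T.d (g x)

/-- `(B, S, ι)` is the de Rham complex `Ω(A)` of the commutative algebra `A`: its degree-zero
part is (a copy of) `A` and every morphism from `A` into the degree-zero part of a DGCA extends
uniquely to a morphism of DGCAs. -/
def IsDeRham (F : Type u) [Field F] (A : Type u) [CommRing A] [Algebra F A]
    (B : Type u) [Ring B] [Algebra F B] (S : DGCAOn F B) (ι : A →ₐ[F] B) : Prop :=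
  (∀ a : A, ι a ∈ S.grading 0) ∧
  (∀ b ∈ S.grading 0, ∃ a : A, ι a = b) ∧
  Function.Injective ι ∧
  ∀ (C : Type u) [Ring C] [Algebra F C] (T : DGCAOn F C) (f : A →ₐ[F] C),
    (∀ a : A, f a ∈ T.grading 0) →
    ∃! g : B →ₐ[F] C, IsDGCAHom S T g ∧ ∀ a : A, g (ι a) = f a

open Polynomial

theorem DirectSum.isInternal_of_proj {F M : Type*} [Field F] [AddCommGroup M] [Module F M]
    (V : ℕ → Submodule F M) (p : ℕ → M →ₗ[F] M)
    (hsame : ∀ n, ∀ x ∈ V n, p n x = x) (hne : ∀ m n, m ≠ n → ∀ x ∈ V n, p m x = 0)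
    (hspan : ∀ x, x ∈ ⨆ n, V n) : DirectSum.IsInternal V := by
  rw [DirectSum.isInternal_submodule_iff_iSupIndep_and_iSup_eq_top]
  refine ⟨?_, eq_top_iff.2 fun x _ => hspan x⟩
  intro n
  rw [Submodule.disjoint_def]
  intro x hx hx'
  have hle : (⨆ j, ⨆ (_ : j ≠ n), V j) ≤ LinearMap.ker (p n) :=
    iSup_le fun j => iSup_le fun hj y hy => hne n j hj.symm y hy
  rw [← hsame n x hx]
  exact hle hx'

namespace Polynomial

section mapCoeff

variable {F B : Type*} [Field F] [Ring B] [Algebra F B]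

/-- Apply a linear map to every coefficient of a polynomial. -/
noncomputable def mapCoeff (f : B →ₗ[F] B) : B[X] →ₗ[F] B[X] :=
  lsum fun k => ((monomial k : B →ₗ[B] B[X]).restrictScalars F).comp f

theorem mapCoeff_monomial (f : B →ₗ[F] B) (k : ℕ) (b : B) :
    mapCoeff f (monomial k b) = monomial k (f b) := by
  simp [mapCoeff, lsum_apply]

@[simp]
theorem coeff_mapCoeff (f : B →ₗ[F] B) (P : B[X]) (k : ℕ) :
    (mapCoeff f P).coeff k = f (P.coeff k) := by
  induction P using Polynomial.induction_on' with
  | add P Q hP hQ => simp [hP, hQ]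
  | monomial n b => rw [mapCoeff_monomial, coeff_monomial, coeff_monomial]; split_ifs <;> simp

theorem derivative_mapCoeff (f : B →ₗ[F] B) (P : B[X]) :
    derivative (mapCoeff f P) = mapCoeff f (derivative P) := by
  ext k
  simp only [coeff_derivative, coeff_mapCoeff]
  rw [← Nat.cast_succ, ← nsmul_eq_mul', ← nsmul_eq_mul', map_nsmul]

theorem eval_zero_mapCoeff (f : B →ₗ[F] B) (P : B[X]) :
    (mapCoeff f P).eval 0 = f (P.eval 0) := by
  simp [← coeff_zero_eq_eval_zero]

theorem eval_one_mapCoeff (f : B →ₗ[F] B) (P : B[X]) :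
    (mapCoeff f P).eval 1 = f (P.eval 1) := by
  induction P using Polynomial.induction_on' with
  | add P Q hP hQ => simp [hP, hQ]
  | monomial n b => simp [mapCoeff_monomial]

/-- Formal integration of a polynomial from `0` to `1`. -/
noncomputable def unitIntegral : B[X] →ₗ[F] B :=
  lsum fun k => ((k + 1 : F)⁻¹) • LinearMap.id

theorem unitIntegral_monomial (k : ℕ) (b : B) :
    unitIntegral (F := F) (monomial k b) = (k + 1 : F)⁻¹ • b := by
  simp [unitIntegral, lsum_apply]

theorem unitIntegral_mapCoeff (f : B →ₗ[F] B) (P : B[X]) :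
    unitIntegral (F := F) (mapCoeff f P) = f (unitIntegral (F := F) P) := by
  induction P using Polynomial.induction_on' with
  | add P Q hP hQ => simp [hP, hQ]
  | monomial n b => simp [mapCoeff_monomial, unitIntegral_monomial]

theorem unitIntegral_derivative [CharZero F] (P : B[X]) :
    unitIntegral (F := F) (derivative P) = P.eval 1 - P.eval 0 := by
  induction P using Polynomial.induction_on' with
  | add P Q hP hQ => simp only [map_add, hP, hQ, eval_add]; abel
  | monomial n b =>
    rw [derivative_monomial, unitIntegral_monomial]
    rcases n with _ | n
    · simp
    · have hn : (n + 1 : F) ≠ 0 := by exact_mod_cast n.succ_ne_zero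
      rw [← nsmul_eq_mul', ← Nat.cast_smul_eq_nsmul F, smul_smul]
      simp [hn]

/-- The polynomials all of whose coefficients lie in a given subspace. -/
def withCoeffsIn (V : Submodule F B) : Submodule F B[X] where
  carrier := {P | ∀ k, P.coeff k ∈ V}
  zero_mem' k := by simp
  add_mem' hP hQ k := by rw [coeff_add]; exact V.add_mem (hP k) (hQ k)
  smul_mem' c P hP k := by rw [coeff_smul]; exact V.smul_mem c (hP k)

theorem unitIntegral_mem {V : Submodule F B} {P : B[X]} (hP : P ∈ withCoeffsIn V) :
    unitIntegral (F := F) P ∈ V :=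
  V.sum_mem fun k _ => V.smul_mem _ (hP k)

theorem mul_mem_withCoeffsIn {U V W : Submodule F B}
    (h : ∀ x ∈ U, ∀ y ∈ V, x * y ∈ W) {P Q : B[X]} (hP : P ∈ withCoeffsIn U)
    (hQ : Q ∈ withCoeffsIn V) : P * Q ∈ withCoeffsIn W := fun k => by
  rw [coeff_mul]
  exact W.sum_mem fun a _ => h _ (hP _) _ (hQ _)

theorem derivative_mem_withCoeffsIn {V : Submodule F B} {P : B[X]} (hP : P ∈ withCoeffsIn V) :
    derivative P ∈ withCoeffsIn V := fun k => by
  rw [coeff_derivative, ← Nat.cast_succ, ← nsmul_eq_mul']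
  exact V.nsmul_mem (hP _) _

theorem monomial_mem_withCoeffsIn {V : Submodule F B} {b : B} (hb : b ∈ V) (k : ℕ) :
    monomial k b ∈ withCoeffsIn V := fun n => by
  rw [coeff_monomial]
  split_ifs
  exacts [hb, V.zero_mem]

theorem eval_mem_of_withCoeffsIn {V : Submodule F B} {P : B[X]} (hP : P ∈ withCoeffsIn V) :
    P.eval 0 ∈ V ∧ P.eval 1 ∈ V := by
  refine ⟨coeff_zero_eq_eval_zero P ▸ hP 0, ?_⟩
  rw [eval_eq_sum_range]
  exact V.sum_mem fun k _ => by simpa using hP k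

end mapCoeff

end Polynomial

namespace DGCAOn

variable {F B : Type u} [Field F] [Ring B] [Algebra F B] (S : DGCAOn F B)

instance : GradedAlgebra S.grading := S.graded

/-- The grading involution, multiplication by `(-1) ^ n` in degree `n`. -/
noncomputable def involution : B →ₐ[F] B :=
  (DirectSum.toAlgebra F (fun n => S.grading n) (fun n => ((-1 : F) ^ n) • (S.grading n).subtype)
    (by simp) (fun {i j} x y => by
      simp [pow_add, smul_smul, mul_comm])).comp
    (DirectSum.decomposeAlgEquiv S.grading).toAlgHom

theorem involution_of_mem {n : ℕ} {b : B} (hb : b ∈ S.grading n) :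
    S.involution b = ((-1 : F) ^ n) • b := by
  have hcomp : S.involution b = DirectSum.toAddMonoid
      (fun n => (((-1 : F) ^ n) • (S.grading n).subtype).toAddMonoidHom)
      (DirectSum.decompose S.grading b) := rfl
  rw [hcomp, DirectSum.decompose_of_mem _ hb, DirectSum.toAddMonoid_of]
  rfl

theorem map_involution_of_mem {n : ℕ} {P : B[X]} (hP : P ∈ withCoeffsIn (S.grading n)) :
    mapAlgHom S.involution P = ((-1 : F) ^ n) • P := by
  ext k
  simp [S.involution_of_mem (hP k)]

/-- The grading shifted up by one. -/
def shift : ℕ → Submodule F B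
  | 0 => ⊥
  | n + 1 => S.grading n

/-- The projections onto the pieces of the shifted grading. -/
noncomputable def shiftProj : ℕ → B →ₗ[F] B
  | 0 => 0
  | n + 1 => GradedAlgebra.proj S.grading n

theorem proj_same {n : ℕ} {b : B} (hb : b ∈ S.grading n) :
    GradedAlgebra.proj S.grading n b = b := by
  rw [GradedAlgebra.proj_apply, DirectSum.decompose_of_mem_same _ hb]

theorem proj_ne {m n : ℕ} (h : m ≠ n) {b : B} (hb : b ∈ S.grading n) :
    GradedAlgebra.proj S.grading m b = 0 := by
  rw [GradedAlgebra.proj_apply, DirectSum.decompose_of_mem_ne _ hb h.symm]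

theorem shiftProj_same {n : ℕ} {b : B} (hb : b ∈ S.shift n) : S.shiftProj n b = b := by
  cases n with
  | zero => exact ((Submodule.mem_bot F).1 hb).symm
  | succ n => exact S.proj_same hb

theorem shiftProj_ne {m n : ℕ} (h : m ≠ n) {b : B} (hb : b ∈ S.shift n) :
    S.shiftProj m b = 0 := by
  cases n with
  | zero => rw [(Submodule.mem_bot F).1 hb, map_zero]
  | succ n =>
    cases m with
    | zero => rfl
    | succ m => exact S.proj_ne (by simpa using h) hb

theorem mul_mem_grading {i j : ℕ} {x y : B} (hx : x ∈ S.grading i) (hy : y ∈ S.grading j) :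
    x * y ∈ S.grading (i + j) :=
  SetLike.mul_mem_graded hx hy

theorem shift_mul_mem {i j : ℕ} {x y : B} (hx : x ∈ S.shift i) (hy : y ∈ S.grading j) :
    x * y ∈ S.shift (i + j) := by
  cases i with
  | zero => rw [(Submodule.mem_bot F).1 hx, zero_mul]; exact zero_mem _
  | succ i => rw [Nat.succ_add]; exact S.mul_mem_grading hx hy

theorem mul_shift_mem {i j : ℕ} {x y : B} (hx : x ∈ S.grading i) (hy : y ∈ S.shift j) :
    x * y ∈ S.shift (i + j) := by
  cases j with
  | zero => rw [(Submodule.mem_bot F).1 hy, mul_zero]; exact zero_mem _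
  | succ j => exact S.mul_mem_grading hx hy

theorem mapCoeff_d_mul {i : ℕ} {P : B[X]} (hP : P ∈ withCoeffsIn (S.grading i)) (Q : B[X]) :
    mapCoeff S.d (P * Q) = mapCoeff S.d P * Q + ((-1 : F) ^ i) • (P * mapCoeff S.d Q) := by
  ext k
  simp only [coeff_mapCoeff, coeff_mul, coeff_add, coeff_smul, map_sum, Finset.smul_sum,
    ← Finset.sum_add_distrib]
  exact Finset.sum_congr rfl fun a _ => S.leibniz i _ (hP _) _

theorem polynomial_gcomm {i j : ℕ} {P Q : B[X]} (hP : P ∈ withCoeffsIn (S.grading i))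
    (hQ : Q ∈ withCoeffsIn (S.grading j)) : P * Q = ((-1 : F) ^ (i * j)) • (Q * P) := by
  ext k
  simp only [coeff_mul, coeff_smul, Finset.smul_sum]
  rw [← Finset.Nat.sum_antidiagonal_swap]
  exact Finset.sum_congr rfl fun a _ => S.gcomm i j _ (hP _) _ (hQ _)

theorem mapCoeff_d_mem {i : ℕ} {P : B[X]} (hP : P ∈ withCoeffsIn (S.grading i)) :
    mapCoeff S.d P ∈ withCoeffsIn (S.grading (i + 1)) := fun k => by
  rw [coeff_mapCoeff]
  exact S.d_mem _ _ (hP k)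

/-- The algebra `B[t] ⊕ dt B[t]` of polynomial forms on the line with values in `B`; the pair
`(P, Q)` stands for `P + dt Q`. -/
def PathForms (_ : DGCAOn F B) : Type u := B[X] × B[X]

namespace PathForms

variable {S}

noncomputable instance : AddCommGroup S.PathForms := inferInstanceAs (AddCommGroup (B[X] × B[X]))

noncomputable instance : Module F S.PathForms := inferInstanceAs (Module F (B[X] × B[X]))

/-- The form `P + dt Q`. -/
def mk (P Q : B[X]) : S.PathForms := (P, Q)

/-- The component without `dt`. -/
noncomputable def fn : S.PathForms →ₗ[F] B[X] := LinearMap.fst F B[X] B[X]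

/-- The coefficient of `dt`. -/
noncomputable def dt : S.PathForms →ₗ[F] B[X] := LinearMap.snd F B[X] B[X]

@[simp]
theorem fn_mk (P Q : B[X]) : fn (mk P Q : S.PathForms) = P := rfl

@[simp]
theorem dt_mk (P Q : B[X]) : dt (mk P Q : S.PathForms) = Q := rfl

@[ext]
theorem ext {x y : S.PathForms} (h₁ : fn x = fn y) (h₂ : dt x = dt y) : x = y := Prod.ext h₁ h₂

noncomputable instance : One S.PathForms := ⟨mk 1 0⟩

noncomputable instance : Mul S.PathForms :=
  ⟨fun x y => mk (fn x * fn y) (dt x * fn y + mapAlgHom S.involution (fn x) * dt y)⟩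

@[simp]
theorem fn_one : fn (1 : S.PathForms) = 1 := rfl

@[simp]
theorem dt_one : dt (1 : S.PathForms) = 0 := rfl

@[simp]
theorem fn_mul (x y : S.PathForms) : fn (x * y) = fn x * fn y := rfl

@[simp]
theorem dt_mul (x y : S.PathForms) :
    dt (x * y) = dt x * fn y + mapAlgHom S.involution (fn x) * dt y := rfl

noncomputable instance : Ring S.PathForms :=
  { instAddCommGroup, instOne, instMul with
    left_distrib := fun x y z => by
      apply ext
      · simp only [fn_mul, map_add, mul_add]
      · simp only [dt_mul, map_add, mul_add]; abel
    right_distrib := fun x y z => by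
      apply ext
      · simp only [fn_mul, map_add, add_mul]
      · simp only [dt_mul, map_add, add_mul]; abel
    zero_mul := fun x => by
      apply ext
      · simp only [fn_mul, map_zero, zero_mul]
      · simp only [dt_mul, map_zero, zero_mul, add_zero]
    mul_zero := fun x => by
      apply ext
      · simp only [fn_mul, map_zero, mul_zero]
      · simp only [dt_mul, map_zero, mul_zero, add_zero]
    mul_assoc := fun x y z => by
      apply ext
      · simp only [fn_mul, mul_assoc]
      · simp only [dt_mul, fn_mul, map_mul, add_mul, mul_add, mul_assoc, add_assoc]
    one_mul := fun x => by
      apply ext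
      · simp only [fn_mul, fn_one, one_mul]
      · simp only [dt_mul, fn_one, dt_one, map_one, one_mul, zero_mul, zero_add]
    mul_one := fun x => by
      apply ext
      · simp only [fn_mul, fn_one, mul_one]
      · simp only [dt_mul, fn_one, dt_one, mul_one, mul_zero, add_zero] }

noncomputable instance : Algebra F S.PathForms :=
  Algebra.ofModule
    (fun c x y => by
      apply ext
      · simp only [fn_mul, map_smul, smul_mul_assoc]
      · simp only [dt_mul, map_smul, smul_mul_assoc, smul_add])
    (fun c x y => by
      apply ext
      · simp only [fn_mul, map_smul, mul_smul_comm]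
      · simp only [dt_mul, map_smul, mul_smul_comm, smul_add])

variable (S)

/-- Forms of total degree `n`, where `dt` has degree one. -/
noncomputable def grading (n : ℕ) : Submodule F S.PathForms :=
  (withCoeffsIn (S.grading n)).comap fn ⊓ (withCoeffsIn (S.shift n)).comap dt

variable {S}

theorem mem_grading {n : ℕ} {x : S.PathForms} : x ∈ grading S n ↔
    fn x ∈ withCoeffsIn (S.grading n) ∧ dt x ∈ withCoeffsIn (S.shift n) := Iff.rfl

theorem mk_monomial_mem (k : ℕ) (b : B) :
    (mk (monomial k b) 0 : S.PathForms) ∈ ⨆ n, grading S n := by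
  induction b using DirectSum.Decomposition.inductionOn S.grading with
  | zero => rw [map_zero]; exact zero_mem _
  | @homogeneous i m =>
    exact Submodule.mem_iSup_of_mem i (mem_grading.2 ⟨monomial_mem_withCoeffsIn m.2 k, zero_mem _⟩)
  | add x y hx hy =>
    convert add_mem hx hy using 1
    apply ext <;> simp

theorem mk_dt_monomial_mem (k : ℕ) (b : B) :
    (mk 0 (monomial k b) : S.PathForms) ∈ ⨆ n, grading S n := by
  induction b using DirectSum.Decomposition.inductionOn S.grading with
  | zero => rw [map_zero]; exact zero_mem _
  | @homogeneous i m =>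
    exact Submodule.mem_iSup_of_mem (i + 1)
      (mem_grading.2 ⟨zero_mem _, monomial_mem_withCoeffsIn (V := S.shift (i + 1)) m.2 k⟩)
  | add x y hx hy =>
    convert add_mem hx hy using 1
    apply ext <;> simp

theorem mem_iSup_grading (x : S.PathForms) : x ∈ ⨆ n, grading S n := by
  have hfn : ∀ P : B[X], (mk P 0 : S.PathForms) ∈ ⨆ n, grading S n := fun P => by
    induction P using Polynomial.induction_on' with
    | add P Q hP hQ =>
      convert add_mem hP hQ using 1
      apply ext <;> simp
    | monomial k b => exact mk_monomial_mem k b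
  have hdt : ∀ Q : B[X], (mk 0 Q : S.PathForms) ∈ ⨆ n, grading S n := fun Q => by
    induction Q using Polynomial.induction_on' with
    | add P Q hP hQ =>
      convert add_mem hP hQ using 1
      apply ext <;> simp
    | monomial k b => exact mk_dt_monomial_mem k b
  convert add_mem (hfn (fn x)) (hdt (dt x)) using 1
  apply ext <;> simp

variable (S) in
theorem isInternal_grading : DirectSum.IsInternal (grading S) := by
  refine DirectSum.isInternal_of_proj _
    (fun n => ((mapCoeff (GradedAlgebra.proj S.grading n)).comp fn).prod
      ((mapCoeff (S.shiftProj n)).comp dt)) (fun n x hx => ?_) (fun m n hmn x hx => ?_)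
    mem_iSup_grading
  · apply ext
    · ext k
      exact (coeff_mapCoeff _ _ _).trans (S.proj_same (hx.1 k))
    · ext k
      exact (coeff_mapCoeff _ _ _).trans (S.shiftProj_same (hx.2 k))
  · apply ext
    · ext k
      exact (coeff_mapCoeff _ _ _).trans (S.proj_ne hmn (hx.1 k))
    · ext k
      exact (coeff_mapCoeff _ _ _).trans (S.shiftProj_ne hmn (hx.2 k))

theorem one_mem_grading : (1 : S.PathForms) ∈ grading S 0 :=
  mem_grading.2 ⟨monomial_mem_withCoeffsIn (SetLike.one_mem_graded S.grading) 0, zero_mem _⟩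

theorem mul_mem_grading {i j : ℕ} {x y : S.PathForms} (hx : x ∈ grading S i)
    (hy : y ∈ grading S j) : x * y ∈ grading S (i + j) := by
  refine mem_grading.2 ⟨?_, ?_⟩
  · exact mul_mem_withCoeffsIn (fun _ ha _ hb => S.mul_mem_grading ha hb) hx.1 hy.1
  · rw [dt_mul, S.map_involution_of_mem hx.1]
    exact add_mem (mul_mem_withCoeffsIn (fun _ ha _ hb => S.shift_mul_mem ha hb) hx.2 hy.1)
      (mul_mem_withCoeffsIn (fun _ ha _ hb => S.mul_shift_mem ha hb)
        (Submodule.smul_mem _ _ hx.1) hy.2)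

noncomputable instance : GradedAlgebra (grading S) :=
  { (isInternal_grading S).chooseDecomposition with
    one_mem := one_mem_grading
    mul_mem := fun _ _ _ _ => mul_mem_grading }

/-- The differential `d (P + dt Q) = d P + dt (∂P/∂t - d Q)`. -/
noncomputable def differential : S.PathForms →ₗ[F] S.PathForms :=
  ((mapCoeff S.d).comp fn).prod
    ((derivative.restrictScalars F).comp fn - (mapCoeff S.d).comp dt)

@[simp]
theorem fn_differential (x : S.PathForms) : fn (differential x) = mapCoeff S.d (fn x) := rfl

@[simp]
theorem dt_differential (x : S.PathForms) :
    dt (differential x) = derivative (fn x) - mapCoeff S.d (dt x) := rfl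

theorem differential_mem {n : ℕ} {x : S.PathForms} (hx : x ∈ grading S n) :
    differential x ∈ grading S (n + 1) := by
  refine mem_grading.2 ⟨S.mapCoeff_d_mem hx.1, ?_⟩
  rw [dt_differential]
  refine sub_mem (derivative_mem_withCoeffsIn hx.1) fun k => ?_
  rw [coeff_mapCoeff]
  have hk := hx.2 k
  cases n with
  | zero => rw [show (dt x).coeff k = 0 from hk, map_zero]; exact zero_mem _
  | succ n => exact S.d_mem n _ hk

theorem differential_sq (x : S.PathForms) : differential (differential x) = 0 := by
  have hd : ∀ P, mapCoeff S.d (mapCoeff S.d P) = 0 := fun P => by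
    ext k
    simp [S.d_sq]
  apply ext
  · simp [hd]
  · simp [hd, derivative_mapCoeff]

theorem dt_eq_zero {x : S.PathForms} (hx : x ∈ grading S 0) : dt x = 0 := by
  ext k
  exact hx.2 k

theorem differential_mul {i : ℕ} {x : S.PathForms} (hx : x ∈ grading S i) (y : S.PathForms) :
    differential (x * y) = differential x * y + ((-1 : F) ^ i) • (x * differential y) := by
  have hsign : ((-1 : F) ^ i) * (-1) ^ i = 1 := by rw [← mul_pow]; simp
  apply ext
  · simpa using S.mapCoeff_d_mul hx.1 (fn y)
  · have hdt : mapCoeff S.d (dt x * fn y) =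
        mapCoeff S.d (dt x) * fn y - ((-1 : F) ^ i) • (dt x * mapCoeff S.d (fn y)) := by
      cases i with
      | zero => simp [dt_eq_zero hx]
      | succ i => rw [S.mapCoeff_d_mul hx.2]; simp [pow_succ]
    simp only [dt_differential, dt_mul, fn_mul, fn_differential, map_add, map_smul, hdt,
      S.map_involution_of_mem hx.1, S.map_involution_of_mem (S.mapCoeff_d_mem hx.1),
      smul_mul_assoc, S.mapCoeff_d_mul hx.1, derivative_mul, smul_add, smul_smul, hsign, one_smul,
      mul_sub, sub_mul, smul_sub, pow_succ, mul_neg, mul_one, neg_smul, neg_mul]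
    abel

theorem mul_gcomm {i j : ℕ} {x y : S.PathForms} (hx : x ∈ grading S i) (hy : y ∈ grading S j) :
    x * y = ((-1 : F) ^ (i * j)) • (y * x) := by
  have hcross : ∀ {i j : ℕ} {x y : S.PathForms}, x ∈ grading S i → y ∈ grading S j →
      dt x * fn y = ((-1 : F) ^ (i * j)) • (mapAlgHom S.involution (fn y) * dt x) := by
    intro i j x y hx hy
    rw [S.map_involution_of_mem hy.1, smul_mul_assoc, smul_smul, ← pow_add]
    cases i with
    | zero => simp [dt_eq_zero hx]
    | succ i =>
      rw [S.polynomial_gcomm hx.2 hy.1, show (i + 1) * j + j = i * j + 2 * j by ring, pow_add,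
        pow_mul _ 2]
      simp
  apply ext
  · simpa using S.polynomial_gcomm hx.1 hy.1
  · have hsign : ((-1 : F) ^ (i * j)) * (-1) ^ (j * i) = 1 := by
      rw [mul_comm j i, ← mul_pow]; simp
    rw [map_smul, dt_mul, dt_mul, hcross hx hy, smul_add, hcross hy hx, smul_smul, hsign, one_smul,
      add_comm]

variable (S) in
/-- The differential graded-commutative algebra of polynomial forms on the line. -/
noncomputable def dgca : DGCAOn F S.PathForms where
  grading := grading S
  graded := inferInstance
  d := differential
  d_mem _ _ := differential_mem
  d_sq := differential_sq
  leibniz _ _ := differential_mul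
  gcomm _ _ _ hx _ := mul_gcomm hx

variable (S) in
/-- Restriction of forms to the point `c`. -/
noncomputable def evalAt (c : B) (hc : ∀ b, Commute b c) : S.PathForms →ₐ[F] B :=
  AlgHom.ofLinearMap
    { toFun := fun x => (fn x).eval c
      map_add' := fun x y => by simp
      map_smul' := fun r x => by simp }
    (by simp)
    (fun x y => by
      change (fn (x * y)).eval c = _
      rw [fn_mul]
      exact eval₂_mul_noncomm _ _ fun k => hc _)

variable (S) in
/-- The inclusion `A[t] → B[t]` of functions into forms induced by `f : A → B`. -/
noncomputable def ofFunctions {A : Type u} [CommRing A] [Algebra F A] (f : A →ₐ[F] B) :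
    A[X] →ₐ[F] S.PathForms :=
  AlgHom.ofLinearMap
    ((mapAlgHom f).toLinearMap.prod 0)
    (ext (map_one (mapAlgHom f)) rfl)
    (fun p q => ext (map_mul (mapAlgHom f) p q) (by
      change 0 = (0 : B[X]) * _ + _ * 0
      simp))

theorem ofFunctions_mem {A : Type u} [CommRing A] [Algebra F A] {f : A →ₐ[F] B}
    (hf : ∀ a, f a ∈ S.grading 0) (p : A[X]) : ofFunctions S f p ∈ grading S 0 := by
  refine mem_grading.2 ⟨fun k => ?_, zero_mem _⟩
  change (mapAlgHom f p).coeff k ∈ _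
  simpa using hf _

theorem evalAt_ofFunctions {A : Type u} [CommRing A] [Algebra F A] (f : A →ₐ[F] B) (c : A)
    (hc : ∀ b, Commute b (f c)) (p : A[X]) :
    evalAt S (f c) hc (ofFunctions S f p) = f (p.eval c) :=
  eval_map_apply (f : A →+* B) c

theorem isDGCAHom_evalAt {c : B} (hc : ∀ b, Commute b c)
    (hmem : ∀ n, ∀ P ∈ withCoeffsIn (S.grading n), P.eval c ∈ S.grading n)
    (hd : ∀ P, (mapCoeff S.d P).eval c = S.d (P.eval c)) :
    IsDGCAHom (dgca S) S (evalAt S c hc) :=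
  ⟨fun n _ hx => hmem n _ hx.1, fun _ => hd _⟩

/-- A closed form on the line has cohomologous restrictions to `0` and `1`, the difference being
the differential of the integral of the `dt` component. -/
theorem eval_sub_eval_eq_d [CharZero F] {x : S.PathForms} (hx : differential x = 0) :
    (fn x).eval 0 - (fn x).eval 1 = S.d (-unitIntegral (F := F) (dt x)) := by
  have hdt : derivative (fn x) = mapCoeff S.d (dt x) := by
    rw [← sub_eq_zero, ← dt_differential, hx, map_zero]
  rw [map_neg, ← unitIntegral_mapCoeff, ← hdt, unitIntegral_derivative, neg_sub]

theorem unitIntegral_dt_mem {n : ℕ} {x : S.PathForms} (hx : x ∈ grading S n) :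
    unitIntegral (F := F) (dt x) ∈ S.grading (n - 1) := by
  cases n with
  | zero => rw [dt_eq_zero hx, map_zero]; exact zero_mem _
  | succ n => exact unitIntegral_mem hx.2

end PathForms

end DGCAOn

/-- **Homotopy invariance of de Rham cohomology in characteristic zero.**  Let `F` be a field of
characteristic `0`, `A` a commutative unital `F`-algebra, `Ω(A)` (given by `S, ι`) and `Ω(A[x])`
(given by `S', ι'`) the de Rham complexes of `A` and `A[x]`, and let `g₀, g₁ : Ω(A[x]) → Ω(A)`
be the cochain (DGCA) maps induced by the evaluations `x ↦ 0` and `x ↦ 1`.  Then `g₀` and `g₁`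
induce equal maps on de Rham cohomology in every degree: every closed element `ω` of degree `n`
satisfies `g₀ ω − g₁ ω = d η` for some `η` of degree `n − 1`. -/
theorem stmt_11 {F A : Type u} [Field F] [CharZero F] [CommRing A] [Algebra F A]
    {B : Type u} [Ring B] [Algebra F B] (S : DGCAOn F B) (ι : A →ₐ[F] B)
    (hS : IsDeRham F A B S ι)
    {B' : Type u} [Ring B'] [Algebra F B'] (S' : DGCAOn F B')
    (ι' : Polynomial A →ₐ[F] B') (hS' : IsDeRham F (Polynomial A) B' S' ι')
    (g₀ g₁ : B' →ₐ[F] B)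
    (hg₀ : IsDGCAHom S' S g₀) (hg₁ : IsDGCAHom S' S g₁)
    (h₀ : ∀ p : Polynomial A, g₀ (ι' p) = ι (p.eval 0))
    (h₁ : ∀ p : Polynomial A, g₁ (ι' p) = ι (p.eval 1)) :
    ∀ n : ℕ, ∀ ω ∈ S'.grading n, S'.d ω = 0 →
      ∃ η ∈ S.grading (n - 1), g₀ ω - g₁ ω = S.d η := by
  obtain ⟨φ, ⟨hφ, hφι⟩, -⟩ := hS'.2.2.2 S.PathForms (DGCAOn.PathForms.dgca S)
    (DGCAOn.PathForms.ofFunctions S ι) (DGCAOn.PathForms.ofFunctions_mem hS.1)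
  have factor : ∀ (g : B' →ₐ[F] B), IsDGCAHom S' S g → ∀ c : A, ∀ hc : ∀ b, Commute b (ι c),
      (∀ p, g (ι' p) = ι (p.eval c)) →
      IsDGCAHom (DGCAOn.PathForms.dgca S) S (DGCAOn.PathForms.evalAt S (ι c) hc) →
      ∀ ω, g ω = (DGCAOn.PathForms.fn (φ ω)).eval (ι c) := by
    intro g hg c hc hgι hev ω
    have hext : ∀ p, (DGCAOn.PathForms.evalAt S (ι c) hc).comp φ (ι' p) = ι (p.eval c) :=
        fun p => by
      rw [AlgHom.comp_apply, hφι, DGCAOn.PathForms.evalAt_ofFunctions]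
    have heq : g = (DGCAOn.PathForms.evalAt S (ι c) hc).comp φ :=
      (hS'.2.2.2 B S (g.comp ι') fun p => hgι p ▸ hS.1 _).unique ⟨hg, fun _ => rfl⟩
        ⟨⟨fun n x hx => hev.1 n _ (hφ.1 n x hx), fun x => by
          rw [AlgHom.comp_apply, hφ.2, hev.2, AlgHom.comp_apply]⟩,
          fun p => (hext p).trans (hgι p).symm⟩
    rw [heq]
    rfl
  intro n ω hω hdω
  have hzero := factor g₀ hg₀ 0 (by simp) h₀ (DGCAOn.PathForms.isDGCAHom_evalAt _
    (by simpa using fun n P hP => (eval_mem_of_withCoeffsIn hP).1)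
    (by simpa using eval_zero_mapCoeff S.d)) ω
  have hone := factor g₁ hg₁ 1 (by simp) h₁ (DGCAOn.PathForms.isDGCAHom_evalAt _
    (by simpa using fun n P hP => (eval_mem_of_withCoeffsIn hP).2)
    (by simpa using eval_one_mapCoeff S.d)) ω
  have hclosed : DGCAOn.PathForms.differential (φ ω) = 0 := by
    rw [← map_zero φ, ← hdω]
    exact (hφ.2 ω).symm
  refine ⟨_, neg_mem (DGCAOn.PathForms.unitIntegral_dt_mem (hφ.1 n ω hω)), ?_⟩
  rw [hzero, hone, map_zero, map_one, DGCAOn.PathForms.eval_sub_eval_eq_d hclosed]
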